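/- Suppose m_j = 2 for all j ≥ 1 (so M_n = 2^n). Then for every n ≥ 1 and every y' ∈ [0,1): (H*_n)^{−1}( H*_n(y') − 2^{−n} mod 1 ) equals y' − 3·2^{−(j+1)} + 1 if 2^{−(j+1)} ≤ y' < 2^{−j} for some j ∈ {0,…,n−1}, and equals y' + 1 − 2^{−n} if 0 ≤ y' < 2^{−n}. -/

import Mathlib

open MeasureTheory Set

noncomputable section

/-- `R_{M,m} : {0,…,Mm−1} → {0,…,Mm−1}`, `R_{M,m}(i) = M·(i mod m) + ⌊i/m⌋`. -/
def Rmap (M m i : ℕ) : ℕ := M * (i % m) + i / m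

/-- One shuffle step `h*_{M,m}` on `[0,1)`:
`h*_{M,m}(y) = R_{M,m}(⌊Mm·y⌋)/(Mm) + (y − ⌊Mm·y⌋/(Mm))`. -/
noncomputable def hstar (M m : ℕ) (y : ℝ) : ℝ :=
  (Rmap M m ⌊(M * m : ℝ) * y⌋₊ : ℝ) / (M * m : ℝ) + (y - (⌊(M * m : ℝ) * y⌋₊ : ℝ) / (M * m : ℝ))

/-- `M_n := m_1 ⋯ m_n` (so `M_0 = 1`). -/
def Mprod (m : ℕ → ℕ) (n : ℕ) : ℕ := ∏ j ∈ Finset.Icc 1 n, m j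

/-- The shuffle `H*_n := h*_{M_{n−1},m_n} ∘ ⋯ ∘ h*_{M_1,m_2} ∘ h*_{M_0,m_1}`, `H*_0 = id`. -/
noncomputable def Hstar (m : ℕ → ℕ) : ℕ → ℝ → ℝ
  | 0 => id
  | n + 1 => hstar (Mprod m n) (m (n + 1)) ∘ Hstar m n

/-- Reversal of the `n` lowest binary digits of `k`. -/
def bitRev : ℕ → ℕ → ℕ
  | 0, _ => 0
  | n + 1, k => 2 ^ n * (k % 2) + bitRev n (k / 2)

lemma bitRev_lt (n k : ℕ) : bitRev n k < 2 ^ n := by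
  induction n generalizing k with
  | zero => simp [bitRev]
  | succ n ih =>
    have h := ih (k / 2)
    rw [bitRev, pow_succ]
    rcases Nat.mod_two_eq_zero_or_one k with hk | hk <;> rw [hk] <;> omega

lemma bitRev_zero_right (n : ℕ) : bitRev n 0 = 0 := by
  induction n with
  | zero => rfl
  | succ n ih => simp [bitRev, ih]

lemma bitRev_succ_of_lt {n k : ℕ} (hk : k < 2 ^ n) : bitRev (n + 1) k = 2 * bitRev n k := by
  induction n generalizing k with
  | zero =>
    obtain rfl : k = 0 := by simpa using hk
    simp [bitRev]
  | succ n ih =>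
    rw [pow_succ] at hk
    rw [bitRev, ih (by omega), bitRev]
    ring

lemma bitRev_succ_add_two_pow {n k : ℕ} (hk : k < 2 ^ n) :
    bitRev (n + 1) (k + 2 ^ n) = 2 * bitRev n k + 1 := by
  induction n generalizing k with
  | zero =>
    obtain rfl : k = 0 := by simpa using hk
    simp [bitRev]
  | succ n ih =>
    rw [pow_succ] at hk
    have hmod : (k + 2 ^ (n + 1)) % 2 = k % 2 := by rw [pow_succ]; omega
    have hdiv : (k + 2 ^ (n + 1)) / 2 = k / 2 + 2 ^ n := by rw [pow_succ]; omega
    rw [bitRev, hmod, hdiv, ih (by omega), bitRev]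
    ring

lemma bitRev_add_one_of_add_eq {i r : ℕ} (hr : r < 2 ^ i) (j l : ℕ)
    (hl : l + 2 * 2 ^ i = r + 2 ^ (i + j + 1)) :
    bitRev (i + j + 1) l + 1 = bitRev (i + j + 1) (r + 2 ^ i) := by
  induction j generalizing l with
  | zero =>
    obtain rfl : l = r := by rw [add_zero, pow_succ] at hl; omega
    rw [add_zero, bitRev_succ_of_lt hr, bitRev_succ_add_two_pow hr]
  | succ j ih =>
    have hpow : 2 * 2 ^ i ≤ 2 ^ (i + j + 1) := by
      rw [← pow_succ']
      exact Nat.pow_le_pow_right two_pos (by omega)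
    rw [← add_assoc, pow_succ] at hl
    obtain ⟨l, rfl⟩ : ∃ l', l = l' + 2 ^ (i + j + 1) :=
      ⟨l - 2 ^ (i + j + 1), by omega⟩
    have h := ih l (by omega)
    rw [← add_assoc, bitRev_succ_add_two_pow (by omega),
      bitRev_succ_of_lt (n := i + j + 1) (k := r + 2 ^ i) (by omega), ← h]
    ring

lemma bitRev_two_pow_sub_one (n : ℕ) : bitRev n (2 ^ n - 1) + 1 = 2 ^ n := by
  induction n with
  | zero => rfl
  | succ n ih =>
    have hpos : 0 < 2 ^ n := by positivity
    have h : 2 ^ (n + 1) - 1 = 2 ^ n - 1 + 2 ^ n := by rw [pow_succ]; omega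
    rw [h, bitRev_succ_add_two_pow (by omega), pow_succ]
    omega

lemma Mprod_two (n : ℕ) : Mprod (fun _ => 2) n = 2 ^ n := by
  simp [Mprod]

lemma Hstar_two_eq {n k : ℕ} {y : ℝ} (hk : k < 2 ^ n) (hky : (k : ℝ) ≤ 2 ^ n * y)
    (hyk : 2 ^ n * y < k + 1) :
    Hstar (fun _ => 2) n y = (bitRev n k : ℝ) / 2 ^ n + (y - (k : ℝ) / 2 ^ n) := by
  induction n generalizing k with
  | zero =>
    obtain rfl : k = 0 := by simpa using hk
    simp [Hstar, bitRev]
  | succ n ih =>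
    rw [pow_succ] at hk hky hyk
    have hdm : (k : ℝ) = 2 * (k / 2 : ℕ) + (k % 2 : ℕ) := by
      exact_mod_cast (Nat.div_add_mod k 2).symm
    have hmod0 : (0 : ℝ) ≤ (k % 2 : ℕ) := Nat.cast_nonneg _
    have hmod1 : ((k % 2 : ℕ) : ℝ) ≤ 1 := by
      exact_mod_cast Nat.le_of_lt_succ (Nat.mod_lt k two_pos)
    have hH := ih (k := k / 2) (by omega) (by linarith) (by linarith)
    have hfloor : ⌊(2 ^ n * 2 : ℝ) * Hstar (fun _ => 2) n y⌋₊
        = 2 * bitRev n (k / 2) + k % 2 := by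
      have hmul : (2 ^ n * 2 : ℝ) * Hstar (fun _ => 2) n y
          = 2 * bitRev n (k / 2) + (2 ^ n * 2 * y - 2 * (k / 2 : ℕ)) := by
        rw [hH]
        field_simp
      have hrev : (0 : ℝ) ≤ bitRev n (k / 2) := Nat.cast_nonneg _
      rw [hmul, Nat.floor_eq_iff (by linarith)]
      push_cast at hdm ⊢
      constructor <;> linarith
    have hR : Rmap (2 ^ n) 2 (2 * bitRev n (k / 2) + k % 2) = bitRev (n + 1) k := by
      rw [Rmap, bitRev]
      congr 2 <;> omega
    rw [Hstar, Function.comp_apply, Mprod_two, hstar]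
    push_cast
    rw [hfloor, hR, hH, pow_succ]
    push_cast at hdm ⊢
    rw [hdm]
    field_simp
    ring

lemma Hstar_two_translate {n k l : ℕ} {y : ℝ} (hk : k < 2 ^ n) (hl : l < 2 ^ n)
    (hky : (k : ℝ) ≤ 2 ^ n * y) (hyk : 2 ^ n * y < k + 1) (c : ℤ)
    (hc : (bitRev n l : ℝ) + 1 = bitRev n k + 2 ^ n * c) :
    y + ((l : ℝ) - k) / 2 ^ n ∈ Ico (0 : ℝ) 1 ∧
      Hstar (fun _ => 2) n (y + ((l : ℝ) - k) / 2 ^ n)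
        = Int.fract (Hstar (fun _ => 2) n y - (2 : ℝ) ^ (-(n : ℤ))) := by
  have hpos : (0 : ℝ) < 2 ^ n := by positivity
  have hl0 : (0 : ℝ) ≤ l := Nat.cast_nonneg l
  have hl1 : (l : ℝ) + 1 ≤ 2 ^ n := by exact_mod_cast hl
  have hr0 : (0 : ℝ) ≤ bitRev n l := Nat.cast_nonneg _
  have hr1 : (bitRev n l : ℝ) + 1 ≤ 2 ^ n := by exact_mod_cast bitRev_lt n l
  have hmul : 2 ^ n * (y + ((l : ℝ) - k) / 2 ^ n) = 2 ^ n * y + l - k := by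
    field_simp
    ring
  have hval : (bitRev n l : ℝ) / 2 ^ n + (y + ((l : ℝ) - k) / 2 ^ n - l / 2 ^ n)
      = (bitRev n l + (2 ^ n * y - k)) / 2 ^ n := by
    field_simp
    ring
  refine ⟨⟨?_, ?_⟩, ?_⟩
  · refine nonneg_of_mul_nonneg_right ?_ hpos
    linarith
  · refine lt_of_mul_lt_mul_left ?_ hpos.le
    linarith
  · rw [Hstar_two_eq hl (by linarith) (by linarith), Hstar_two_eq hk hky hyk, hval, eq_comm,
      Int.fract_eq_iff]
    refine ⟨div_nonneg (by linarith) hpos.le, (div_lt_one hpos).2 (by linarith), -c, ?_⟩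
    rw [eq_sub_of_add_eq hc, zpow_neg, zpow_natCast]
    push_cast
    field_simp
    ring

/-- formula `eq:AdjacentMinusBinaryReversal`: with `m_j = 2` for all `j` (so
`M_n = 2^n`), for every `n ≥ 1` and `y' ∈ [0,1)`, the preimage under the bijection `H*_n` of
`H*_n(y') − 2^{−n} mod 1` is `y' − 3·2^{−(j+1)} + 1` when `2^{−(j+1)} ≤ y' < 2^{−j}` for some
`j ∈ {0,…,n−1}`, and is `y' + 1 − 2^{−n}` when `0 ≤ y' < 2^{−n}`. (Being the preimage in
`[0,1)` is expressed by: the stated value lies in `[0,1)` and is mapped by `H*_n` to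
`Int.fract (H*_n(y') − 2^{−n})`.) -/
theorem shuffle_adjacent_minus_binary
    (n : ℕ) (hn : 1 ≤ n) (y' : ℝ) (hy' : y' ∈ Set.Ico (0:ℝ) 1) :
    (∀ j : ℕ, j < n →
      (2:ℝ) ^ (-(j:ℤ) - 1) ≤ y' → y' < (2:ℝ) ^ (-(j:ℤ)) →
        (y' - 3 * (2:ℝ) ^ (-(j:ℤ) - 1) + 1 ∈ Set.Ico (0:ℝ) 1 ∧
         Hstar (fun _ => 2) n (y' - 3 * (2:ℝ) ^ (-(j:ℤ) - 1) + 1)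
           = Int.fract (Hstar (fun _ => 2) n y' - (2:ℝ) ^ (-(n:ℤ))))) ∧
    (y' < (2:ℝ) ^ (-(n:ℤ)) →
      (y' + 1 - (2:ℝ) ^ (-(n:ℤ)) ∈ Set.Ico (0:ℝ) 1 ∧
       Hstar (fun _ => 2) n (y' + 1 - (2:ℝ) ^ (-(n:ℤ)))
         = Int.fract (Hstar (fun _ => 2) n y' - (2:ℝ) ^ (-(n:ℤ))))) := by
  obtain ⟨hy0, hy1⟩ := hy'
  have hpos : (0 : ℝ) < 2 ^ n := by positivity
  constructor
  · intro j hj hjy hyj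
    obtain ⟨i, rfl⟩ : ∃ i, n = i + j + 1 := ⟨n - j - 1, by omega⟩
    have hunit : (2 : ℝ) ^ (-(j : ℤ) - 1) = 2 ^ i / 2 ^ (i + j + 1) := by
      rw [← neg_add', zpow_neg]
      norm_cast
      rw [add_assoc, pow_add 2 i]
      push_cast
      field_simp
    have hdouble : (2 : ℝ) ^ (-(j : ℤ)) = 2 * 2 ^ i / 2 ^ (i + j + 1) := by
      rw [mul_div_assoc, ← hunit, zpow_sub_one₀ two_ne_zero]
      ring
    rw [hunit, div_le_iff₀' hpos] at hjy
    rw [hdouble, lt_div_iff₀' hpos] at hyj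
    set k := ⌊(2 : ℝ) ^ (i + j + 1) * y'⌋₊ with hk
    have hky : (k : ℝ) ≤ 2 ^ (i + j + 1) * y' := Nat.floor_le (by positivity)
    have hyk : 2 ^ (i + j + 1) * y' < k + 1 := Nat.lt_floor_add_one _
    have hik : 2 ^ i ≤ k := Nat.le_floor (by exact_mod_cast hjy)
    have hki : k < 2 * 2 ^ i := by exact_mod_cast hky.trans_lt hyj
    have hpow : 2 * 2 ^ i ≤ 2 ^ (i + j + 1) := by
      rw [← pow_succ']
      exact Nat.pow_le_pow_right two_pos (by omega)
    obtain ⟨r, hr⟩ : ∃ r, k = r + 2 ^ i := ⟨k - 2 ^ i, by omega⟩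
    obtain ⟨l, hl⟩ : ∃ l, l + 2 * 2 ^ i = r + 2 ^ (i + j + 1) :=
      ⟨r + 2 ^ (i + j + 1) - 2 * 2 ^ i, by omega⟩
    have hrev := bitRev_add_one_of_add_eq (by omega) j l hl
    rw [← hr] at hrev
    have hmain := Hstar_two_translate (by omega) (by omega : l < 2 ^ (i + j + 1)) hky hyk 0
      (by rw [Int.cast_zero, mul_zero, add_zero]; exact_mod_cast hrev)
    have harg : y' + ((l : ℝ) - k) / 2 ^ (i + j + 1)
        = y' - 3 * (2 : ℝ) ^ (-(j : ℤ) - 1) + 1 := by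
      have hr' : (k : ℝ) = r + 2 ^ i := by exact_mod_cast hr
      have hl' : (l : ℝ) + 2 * 2 ^ i = r + 2 ^ (i + j + 1) := by exact_mod_cast hl
      rw [hunit, hr', eq_sub_of_add_eq hl']
      field_simp
      ring
    rwa [harg] at hmain
  · intro hy
    have hinv : (2 : ℝ) ^ (-(n : ℤ)) = 1 / 2 ^ n := by
      rw [zpow_neg, zpow_natCast, one_div]
    have hy2 : 2 ^ n * y' < 1 := by rwa [hinv, lt_div_iff₀' hpos] at hy
    have hmain := Hstar_two_translate (n := n) (k := 0) (l := 2 ^ n - 1) (y := y')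
      (by positivity) (Nat.sub_lt (by positivity) one_pos) (by push_cast; positivity)
      (by simpa using hy2) 1
      (by
        rw [bitRev_zero_right, Int.cast_one, mul_one, Nat.cast_zero, zero_add]
        exact_mod_cast bitRev_two_pow_sub_one n)
    have harg : y' + (((2 ^ n - 1 : ℕ) : ℝ) - (0 : ℕ)) / 2 ^ n
        = y' + 1 - (2 : ℝ) ^ (-(n : ℤ)) := by
      rw [hinv, Nat.cast_sub Nat.one_le_two_pow]
      push_cast
      field_simp
      ring
    rwa [harg] at hmain
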